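/- arXiv:1610.07295 — 3 statements merged into one kernel-verified Lean document; each statement's English description precedes it below -/
import Mathlib

section
/- Let f₁ : ℂ^{n₁} → ℂ be a nonzero weighted homogeneous polynomial with f₁(0) = 0: there exist positive integers w₁, …, w_{n₁} and d such that f₁(λ^{w₁}z₁, …, λ^{w_{n₁}}z_{n₁}) = λ^d f₁(z) for all λ ∈ ℂ and z ∈ ℂ^{n₁}. Let U₂ ⊆ ℂ^{n₂} be open, f₂ : U₂ → ℂ holomorphic, and x₂ ∈ U₂ with f₂(x₂) = 0 and with the germ of f₂ at x₂ nonzero. Identify ℂ^{n₁} × ℂ^{n₂} with ℂ^{n₁+n₂} and set x := (0, x₂). Then for all nonzero complex numbers c₁, c₂ and every rational α ∈ (0,1), the multiplier ideal germs coincide: 𝒥((c₁f₁ ∘ pr₁ + c₂f₂ ∘ pr₂)^α)_x = 𝒥((f₁ ∘ pr₁ + f₂ ∘ pr₂)^α)_x, i.e., a holomorphic germ g at x satisfies the multiplier condition for (c₁f₁ + c₂f₂, α) at x if and only if it satisfies the multiplier condition for (f₁ + f₂, α) at x. -/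
open MeasureTheory Filter Topology

noncomputable section

variable {E : Type*} [NormedAddCommGroup E] [NormedSpace ℂ E] [MeasureSpace E]

/-- `g` is holomorphic on some open neighborhood of `x`. -/
def HolNear (g : E → ℂ) (x : E) : Prop :=
  ∃ W : Set E, IsOpen W ∧ x ∈ W ∧ DifferentiableOn ℂ g W

/-- `g` satisfies the multiplier condition for `(f, α)` at `x`, where `U` is the domain of the
holomorphic function `f`: on some open neighborhood `V ∋ x` contained in the domains of `f` and
`g`, the function `|g|²/|f|^{2α}` is Lebesgue integrable. -/
def MultCond (f : E → ℂ) (U : Set E) (g : E → ℂ) (x : E) (α : ℝ) : Prop :=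
  ∃ V : Set E, IsOpen V ∧ x ∈ V ∧ V ⊆ U ∧ DifferentiableOn ℂ g V ∧
    IntegrableOn (fun y => ‖g y‖ ^ 2 / ‖f y‖ ^ (2 * α)) V volume

/-- `α` is a jumping coefficient of `f` at `x`. -/
def JumpCoeff (f : E → ℂ) (U : Set E) (x : E) (α : ℝ) : Prop :=
  ∃ g : E → ℂ, HolNear g x ∧ (∀ α' : ℝ, α' < α → MultCond f U g x α') ∧ ¬ MultCond f U g x α

/-- the log canonical threshold of `f` at `x`. -/
def Lct (f : E → ℂ) (U : Set E) (x : E) : ℝ :=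
  sSup {α : ℝ | 0 ≤ α ∧ MultCond f U (fun _ => 1) x α}


theorem MvPolynomial.volume_eval_eq_zero {n : ℕ} (P : MvPolynomial (Fin n) ℂ) (hP : P ≠ 0) :
    volume {z : Fin n → ℂ | MvPolynomial.eval z P = 0} = 0 := by
  induction n with
  | zero =>
    obtain ⟨a, rfl⟩ := MvPolynomial.C_surjective (R := ℂ) (Fin 0) P
    have ha : a ≠ 0 := by rintro rfl; simp at hP
    simp [ha]
  | succ n ih =>
    set Q := MvPolynomial.finSuccEquiv ℂ n P with hQ
    have hQ0 : Q ≠ 0 := by simpa [hQ] using hP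
    have hlead := ih Q.leadingCoeff (Polynomial.leadingCoeff_ne_zero.2 hQ0)
    let S : Set (ℂ × (Fin n → ℂ)) :=
      {p | MvPolynomial.eval (Fin.cons p.1 p.2 : Fin (n + 1) → ℂ) P = 0}
    have hS : MeasurableSet S := by
      refine (isClosed_eq (P.continuous_eval.comp ?_) continuous_const).measurableSet
      fun_prop
    have hpre : {z : Fin (n + 1) → ℂ | MvPolynomial.eval z P = 0} =
        MeasurableEquiv.piFinSuccAbove (fun _ : Fin (n + 1) => ℂ) 0 ⁻¹' S := by
      ext z
      simp [S, MeasurableEquiv.piFinSuccAbove, Fin.insertNthEquiv, Fin.cons_self_tail,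
        Fin.removeNth_zero]
    rw [hpre, (volume_preserving_piFinSuccAbove (fun _ : Fin (n + 1) => ℂ) 0).measure_preimage
      hS.nullMeasurableSet, Measure.volume_eq_prod, Measure.prod_apply_symm hS]
    refine (lintegral_eq_zero_iff' ?_).2 ?_
    · exact (measurable_measure_prodMk_right hS).aemeasurable
    · have hae : ∀ᵐ y : Fin n → ℂ, MvPolynomial.eval y Q.leadingCoeff ≠ 0 :=
        measure_eq_zero_iff_ae_notMem.1 hlead
      filter_upwards [hae] with y hy
      have hmap : Q.map (MvPolynomial.eval y) ≠ 0 := fun h => hy <| by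
        simpa using congrArg (fun R : Polynomial ℂ => R.coeff Q.natDegree) h
      refine Set.Finite.measure_zero ?_ _
      refine (Polynomial.finite_setOfPred_isRoot hmap).subset fun t ht => ?_
      simpa [S, MvPolynomial.eval_eq_eval_mv_eval', Polynomial.IsRoot, hQ] using ht

theorem MvPolynomial.volume_eval_eq {n : ℕ} (P : MvPolynomial (Fin n) ℂ) (hP : P ≠ 0)
    (h0 : MvPolynomial.eval 0 P = 0) (t : ℂ) :
    volume {z : Fin n → ℂ | MvPolynomial.eval z P = t} = 0 := by
  have hPt : P - MvPolynomial.C t ≠ 0 := by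
    intro h
    have hPC : P = MvPolynomial.C t := sub_eq_zero.1 h
    have : t = 0 := by simpa [hPC] using h0
    exact hP (by simpa [this] using hPC)
  simpa [sub_eq_zero] using MvPolynomial.volume_eval_eq_zero _ hPt

theorem sq_norm_le_circleAverage {h : ℂ → ℂ} (hh : DiffContOnCl ℂ h (Metric.ball 0 1))
    {lam : ℂ} (hlam : ‖lam‖ ≤ 1 / 2) :
    ENNReal.ofReal (‖h lam‖ ^ 2) ≤
      2 * ∫⁻ θ in Set.Ioc 0 (2 * Real.pi), ENNReal.ofReal (‖h (circleMap 0 1 θ)‖ ^ 2) := by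
  have hh2 : DiffContOnCl ℂ (fun z => h z ^ 2) (Metric.ball 0 |1|) := by
    simpa [pow_two] using hh.smul hh
  have key := hh2.circleAverage_smul_div (w := lam) (by simp; linarith)
  rw [Real.circleAverage_def] at key
  rw [← norm_pow, ← key, ofReal_norm, intervalIntegral.integral_of_le Real.two_pi_pos.le,
    enorm_smul]
  have hpi : ‖(2 * Real.pi)⁻¹‖ₑ ≤ 1 := by
    rw [← ofReal_norm, ← ENNReal.ofReal_one]
    apply ENNReal.ofReal_le_ofReal
    rw [norm_inv, Real.norm_of_nonneg Real.two_pi_pos.le]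
    exact inv_le_one_of_one_le₀ (by linarith [Real.pi_gt_three])
  refine (mul_le_of_le_one_left' hpi).trans ((enorm_integral_le_lintegral_enorm _).trans ?_)
  rw [← lintegral_const_mul' _ _ (by simp)]
  refine lintegral_mono fun θ => ?_
  rw [← ofReal_norm, ← ENNReal.ofReal_ofNat 2, ← ENNReal.ofReal_mul (by norm_num)]
  apply ENNReal.ofReal_le_ofReal
  have h1 : ‖circleMap 0 1 θ‖ = 1 := by simp
  have h2 : 1 / 2 ≤ ‖circleMap 0 1 θ - lam‖ := by
    have := norm_sub_norm_le (circleMap 0 1 θ) lam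
    linarith
  rw [norm_smul, norm_div, sub_zero, h1, norm_pow]
  gcongr
  rw [div_le_iff₀ (by linarith)]
  linarith

theorem lintegral_ball_rpow_norm_lt_top {β : ℝ} (hβ : β < 2) (r : ℝ) :
    ∫⁻ s in Metric.ball (0 : ℂ) r, ENNReal.ofReal (1 / ‖s‖ ^ β) < ⊤ := by
  have : IntegrableOn (fun s : ℂ => 1 / ‖s‖ ^ β) (Metric.ball 0 r) := by
    refine integrableOn_ball_of_norm_le_rpow (C := 1) (α := β) (by simp) (by simpa using hβ) ?_ ?_
    · refine Eventually.of_forall fun s => ?_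
      rw [Real.norm_of_nonneg (by positivity), Real.rpow_neg (norm_nonneg _), one_mul, one_div]
    · exact (by fun_prop : Measurable fun s : ℂ => 1 / ‖s‖ ^ β).aestronglyMeasurable
  exact this.setLIntegral_lt_top

/-- Averaging `‖s a + c b‖ ^ (-β)` over a disc of parameters `s` gives a quantity comparable to
`max ‖a‖ ‖b‖ ^ (-β)`, provided `β < 2`. -/
theorem exists_lintegral_rpow_linear_le {β : ℝ} (hβ0 : 0 < β) (hβ : β < 2) {ρ : ℝ} (hρ : 0 < ρ)
    {c : ℂ} (hc : c ≠ 0) :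
    ∃ C : ENNReal, C ≠ ⊤ ∧ ∀ a b : ℂ,
      ∫⁻ s in Metric.ball (0 : ℂ) ρ, ENNReal.ofReal (1 / ‖s * a + c * b‖ ^ β) ≤
        C * ENNReal.ofReal (1 / max ‖a‖ ‖b‖ ^ β) := by
  have hc' : 0 < ‖c‖ := norm_pos_iff.2 hc
  set I := ∫⁻ s in Metric.ball (0 : ℂ) (3 * ρ), ENNReal.ofReal (1 / ‖s‖ ^ β) with hI
  set L := max 1 (2 * ρ / ‖c‖)
  have hL0 : 0 < L := by positivity
  set D := max (2 / ‖c‖) (1 / ρ)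
  have hD0 : 0 < D := by positivity
  refine ⟨ENNReal.ofReal (L ^ β) * I + ENNReal.ofReal (D ^ β) * volume (Metric.ball (0 : ℂ) ρ),
    ?_, fun a b => ?_⟩
  · refine ENNReal.add_ne_top.2 ⟨ENNReal.mul_ne_top (by simp) ?_, ENNReal.mul_ne_top (by simp) ?_⟩
    · exact (lintegral_ball_rpow_norm_lt_top hβ _).ne
    · exact measure_ball_lt_top.ne
  have inv_le {x y k : ℝ} (hx : 0 < x) (hk : 0 < k) (hy : 0 < y) (h : x ≤ k * y) :
      1 / y ^ β ≤ k ^ β * (1 / x ^ β) := by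
    have := Real.rpow_le_rpow hx.le h hβ0.le
    rw [Real.mul_rpow hk.le hy.le] at this
    have h1 := Real.rpow_pos_of_pos hx β
    have h2 := Real.rpow_pos_of_pos hy β
    rw [mul_one_div, div_le_div_iff₀ h2 h1]
    linarith
  by_cases hab : a = 0 ∧ b = 0
  · simp [hab.1, hab.2, Real.zero_rpow hβ0.ne']
  by_cases h : 2 * ρ * ‖a‖ ≤ ‖c‖ * ‖b‖
  · have hb : 0 < ‖b‖ := by
      rw [norm_pos_iff]
      rintro rfl
      refine hab ⟨norm_le_zero_iff.1 ?_, rfl⟩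
      simp only [norm_zero, mul_zero] at h
      exact nonpos_of_mul_nonpos_right h (by positivity)
    have hmax : 0 < max ‖a‖ ‖b‖ := lt_max_of_lt_right hb
    calc ∫⁻ s in Metric.ball (0 : ℂ) ρ, ENNReal.ofReal (1 / ‖s * a + c * b‖ ^ β)
        ≤ ∫⁻ s in Metric.ball (0 : ℂ) ρ,
            ENNReal.ofReal (D ^ β) * ENNReal.ofReal (1 / max ‖a‖ ‖b‖ ^ β) := by
          refine setLIntegral_mono measurable_const fun s hs => ?_
          rw [← ENNReal.ofReal_mul (by positivity)]
          apply ENNReal.ofReal_le_ofReal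
          have hs' : ‖s‖ < ρ := by simpa using hs
          have h1 : ‖c‖ * ‖b‖ / 2 ≤ ‖s * a + c * b‖ := by
            have h2 := norm_sub_norm_le (c * b) (-(s * a))
            rw [norm_neg, sub_neg_eq_add, norm_mul, norm_mul, add_comm (c * b)] at h2
            have h3 : ‖s‖ * ‖a‖ ≤ ρ * ‖a‖ := by gcongr
            linarith
          refine inv_le hmax hD0 (lt_of_lt_of_le (by positivity) h1) ?_
          refine le_trans ?_ (mul_le_mul_of_nonneg_left h1 hD0.le)
          refine max_le ?_ ?_
          · have : 1 / ρ * (‖c‖ * ‖b‖ / 2) ≤ D * (‖c‖ * ‖b‖ / 2) := by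
              gcongr; exact le_max_right _ _
            refine le_trans ?_ this
            rw [div_mul_eq_mul_div, le_div_iff₀ hρ]
            linarith
          · have : 2 / ‖c‖ * (‖c‖ * ‖b‖ / 2) ≤ D * (‖c‖ * ‖b‖ / 2) := by
              gcongr; exact le_max_left _ _
            refine le_trans (le_of_eq ?_) this
            field_simp
      _ = ENNReal.ofReal (D ^ β) * volume (Metric.ball (0 : ℂ) ρ) *
            ENNReal.ofReal (1 / max ‖a‖ ‖b‖ ^ β) := by
          rw [setLIntegral_const]; ring
      _ ≤ _ := by gcongr; exact le_add_self
  · push Not at h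
    have ha : 0 < ‖a‖ := by
      by_contra h'
      have : ‖a‖ = 0 := le_antisymm (not_lt.1 h') (norm_nonneg _)
      rw [this, mul_zero] at h
      exact absurd h (not_lt.2 (by positivity))
    have ha0 : a ≠ 0 := norm_pos_iff.1 ha
    have hmax : 0 < max ‖a‖ ‖b‖ := lt_max_of_lt_left ha
    set t := c * b / a with ht
    have htn : ‖t‖ < 2 * ρ := by
      rw [ht, norm_div, norm_mul, div_lt_iff₀ ha]; exact h
    have hscale (s : ℂ) : ENNReal.ofReal (1 / ‖s * a + c * b‖ ^ β) =
        ENNReal.ofReal (1 / ‖a‖ ^ β) * ENNReal.ofReal (1 / ‖s + t‖ ^ β) := by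
      have : s * a + c * b = a * (s + t) := by rw [ht]; field_simp
      rw [this, norm_mul, Real.mul_rpow (norm_nonneg _) (norm_nonneg _),
        ← ENNReal.ofReal_mul (by positivity), div_mul_div_comm, one_mul]
    have htrans : ∫⁻ s in Metric.ball (0 : ℂ) ρ, ENNReal.ofReal (1 / ‖s + t‖ ^ β) ≤ I := by
      rw [hI, ← lintegral_indicator measurableSet_ball, ← lintegral_indicator measurableSet_ball,
        ← lintegral_add_right_eq_self
          (fun s => (Metric.ball (0 : ℂ) (3 * ρ)).indicator _ s) t]
      refine lintegral_mono fun s => ?_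
      by_cases hs : s ∈ Metric.ball (0 : ℂ) ρ
      · have hst : s + t ∈ Metric.ball (0 : ℂ) (3 * ρ) := by
          rw [mem_ball_zero_iff] at hs ⊢
          linarith [norm_add_le s t]
        simp [hs, hst]
      · simp [hs]
    calc ∫⁻ s in Metric.ball (0 : ℂ) ρ, ENNReal.ofReal (1 / ‖s * a + c * b‖ ^ β)
        = ENNReal.ofReal (1 / ‖a‖ ^ β) *
            ∫⁻ s in Metric.ball (0 : ℂ) ρ, ENNReal.ofReal (1 / ‖s + t‖ ^ β) := by
          simp_rw [hscale]
          rw [lintegral_const_mul' _ _ (by simp)]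
      _ ≤ (ENNReal.ofReal (L ^ β) * ENNReal.ofReal (1 / max ‖a‖ ‖b‖ ^ β)) * I := by
          gcongr
          rw [← ENNReal.ofReal_mul (by positivity)]
          apply ENNReal.ofReal_le_ofReal
          refine inv_le hmax hL0 ha (max_le ?_ ?_)
          · exact le_mul_of_one_le_left ha.le (le_max_left _ _)
          · have : 2 * ρ / ‖c‖ * ‖a‖ ≤ L * ‖a‖ := by gcongr; exact le_max_right _ _
            refine le_trans ?_ this
            rw [div_mul_eq_mul_div, le_div_iff₀ hc']
            linarith
      _ = ENNReal.ofReal (L ^ β) * I * ENNReal.ofReal (1 / max ‖a‖ ‖b‖ ^ β) := by ring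
      _ ≤ _ := by gcongr; exact le_self_add

/-- The action of `lam` on the first factor of `ℂⁿ × F` with weights `w`. -/
def weightedDilation {n : ℕ} {F : Type*} (w : Fin n → ℕ) (lam : ℂ) (p : (Fin n → ℂ) × F) :
    (Fin n → ℂ) × F :=
  (fun j => lam ^ w j * p.1 j, p.2)

section WeightedDilation

variable {n m : ℕ} (w : Fin n → ℕ)

theorem continuous_weightedDilation :
    Continuous fun q : ℂ × ((Fin n → ℂ) × (Fin m → ℂ)) => weightedDilation w q.1 q.2 := by
  unfold weightedDilation
  fun_prop

theorem differentiable_weightedDilation_left (p : (Fin n → ℂ) × (Fin m → ℂ)) :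
    Differentiable ℂ fun lam => weightedDilation w lam p := by
  unfold weightedDilation
  fun_prop

theorem weightedDilation_comp_inv {F : Type*} {lam : ℂ} (hlam : lam ≠ 0) (p : (Fin n → ℂ) × F) :
    weightedDilation w lam⁻¹ (weightedDilation w lam p) = p := by
  ext j
  · simp [weightedDilation, hlam]
  · rfl

theorem weightedDilation_mem_ball {lam : ℂ} (hlam : ‖lam‖ ≤ 1) {ε : ℝ} (y : Fin m → ℂ)
    {p : (Fin n → ℂ) × (Fin m → ℂ)} (hp : p ∈ Metric.ball ((0 : Fin n → ℂ), y) ε) :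
    weightedDilation w lam p ∈ Metric.ball ((0 : Fin n → ℂ), y) ε := by
  rw [← ball_prod_same, Set.mem_prod, mem_ball_zero_iff] at hp ⊢
  refine ⟨lt_of_le_of_lt ((pi_norm_le_iff_of_nonneg (norm_nonneg _)).2 fun j => ?_) hp.1, hp.2⟩
  rw [weightedDilation, norm_mul, norm_pow]
  exact (mul_le_of_le_one_left (norm_nonneg _) (pow_le_one₀ (norm_nonneg _) hlam)).trans
    (norm_le_pi_norm p.1 j)

theorem measurePreserving_weightedDilation {lam : ℂ} (hlam : ‖lam‖ = 1) :
    MeasurePreserving (weightedDilation w lam : (Fin n → ℂ) × (Fin m → ℂ) → _) := by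
  have hmul (u : ℂ) (hu : ‖u‖ = 1) : MeasurePreserving (fun z : ℂ => u * z) := by
    have := (rotation ⟨u, mem_sphere_zero_iff_norm.2 hu⟩).measurePreserving
    exact this
  have h1 : MeasurePreserving (fun (z : Fin n → ℂ) j => lam ^ w j * z j) :=
    volume_preserving_pi fun j => hmul _ (by simp [hlam])
  exact h1.prod (MeasurePreserving.id (volume : Measure (Fin m → ℂ)))

theorem exists_map_weightedDilation_eq_smul {lam : ℂ} (hlam : lam ≠ 0) :
    ∃ K : ENNReal, K ≠ 0 ∧ Measure.map (weightedDilation w lam)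
      (volume : Measure ((Fin n → ℂ) × (Fin m → ℂ))) = K • volume := by
  let e : ((Fin n → ℂ) × (Fin m → ℂ)) ≃ₗ[ℝ] ((Fin n → ℂ) × (Fin m → ℂ)) :=
    { toFun := weightedDilation w lam
      invFun := weightedDilation w lam⁻¹
      map_add' := fun p q => by ext j <;> simp [weightedDilation, mul_add]
      map_smul' := fun r p => by ext j <;> simp [weightedDilation]; ring
      left_inv := weightedDilation_comp_inv w hlam
      right_inv := fun p => by
        simpa using weightedDilation_comp_inv w (inv_ne_zero hlam) p }
  have hpi (k : ℕ) : (volume : Measure (Fin k → ℂ)).IsAddHaarMeasure :=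
    inferInstanceAs (Measure.pi fun _ : Fin k => (volume : Measure ℂ)).IsAddHaarMeasure
  have : (volume : Measure ((Fin n → ℂ) × (Fin m → ℂ))).IsAddHaarMeasure :=
    Measure.prod.instIsAddHaarMeasure _ _
  have hdet : LinearMap.det (e : ((Fin n → ℂ) × (Fin m → ℂ)) →ₗ[ℝ] _) ≠ 0 := e.isUnit_det'.ne_zero
  have := Measure.map_linearMap_addHaar_eq_smul_addHaar
    (volume : Measure ((Fin n → ℂ) × (Fin m → ℂ))) hdet
  exact ⟨_, by simpa using hdet, this⟩

end WeightedDilation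

section Integrability

variable {n m : ℕ} {w : Fin n → ℕ} {d : ℕ} {a : (Fin n → ℂ) → ℂ} {b : (Fin m → ℂ) → ℂ}
  {G : (Fin n → ℂ) × (Fin m → ℂ) → ℂ} {β : ℝ}

theorem setLIntegral_comp_weightedDilation_le {lam : ℂ} (hlam : ‖lam‖ = 1)
    {F : (Fin n → ℂ) × (Fin m → ℂ) → ENNReal} (hF : Measurable F) (y : Fin m → ℂ) (ε : ℝ) :
    ∫⁻ p in Metric.ball ((0 : Fin n → ℂ), y) ε, F (weightedDilation w lam p) ≤
      ∫⁻ p in Metric.ball ((0 : Fin n → ℂ), y) ε, F p := by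
  rw [← lintegral_indicator measurableSet_ball, ← lintegral_indicator measurableSet_ball,
    ← (measurePreserving_weightedDilation w hlam).lintegral_comp (hF.indicator measurableSet_ball)]
  refine lintegral_mono fun p => ?_
  by_cases hp : p ∈ Metric.ball ((0 : Fin n → ℂ), y) ε
  · simp only [Set.indicator_of_mem hp,
      Set.indicator_of_mem (weightedDilation_mem_ball w hlam.le y hp), le_refl]
  · simp [hp]

theorem exists_setLIntegral_lt_top_of_max (ha : Measurable a) (hb : Measurable b)
    (hhom : ∀ (lam : ℂ) (z : Fin n → ℂ), a (fun j => lam ^ w j * z j) = lam ^ d * a z)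
    (hd : 0 < d) (hβ0 : 0 < β) (hβ : β < 2) {y : Fin m → ℂ} {ε : ℝ} (hε : 0 < ε)
    (hG : Measurable G) (hGd : DifferentiableOn ℂ G (Metric.ball (0, y) ε))
    (hfin : ∫⁻ p in Metric.ball (0, y) ε,
      ENNReal.ofReal (‖G p‖ ^ 2) * ENNReal.ofReal (1 / max ‖a p.1‖ ‖b p.2‖ ^ β) < ⊤)
    {c₁ c₂ : ℂ} (hc₁ : c₁ ≠ 0) (hc₂ : c₂ ≠ 0) :
    ∃ V, IsOpen V ∧ ((0 : Fin n → ℂ), y) ∈ V ∧ V ⊆ Metric.ball (0, y) ε ∧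
      ∫⁻ p in V, ENNReal.ofReal (‖G p‖ ^ 2) *
        ENNReal.ofReal (1 / ‖c₁ * a p.1 + c₂ * b p.2‖ ^ β) < ⊤ := by
  set V := Metric.ball ((0 : Fin n → ℂ), y) ε
  set S : (Fin n → ℂ) × (Fin m → ℂ) → ENNReal := fun p =>
    ∫⁻ θ in Set.Ioc 0 (2 * Real.pi),
      ENNReal.ofReal (‖G (weightedDilation w (circleMap 0 1 θ) p)‖ ^ 2)
  have hdil : Measurable fun q : ((Fin n → ℂ) × (Fin m → ℂ)) × ℝ =>
      weightedDilation w (circleMap 0 1 q.2) q.1 :=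
    ((continuous_weightedDilation w).comp
      (((continuous_circleMap 0 1).comp continuous_snd).prodMk continuous_fst)).measurable
  have hSint : Measurable fun q : ((Fin n → ℂ) × (Fin m → ℂ)) × ℝ =>
      ENNReal.ofReal (‖G (weightedDilation w (circleMap 0 1 q.2) q.1)‖ ^ 2) :=
    ((hG.comp hdil).norm.pow_const 2).ennreal_ofReal
  have hSm : Measurable S := hSint.lintegral_prod_right'
  have hMm : Measurable fun p : (Fin n → ℂ) × (Fin m → ℂ) =>
      ENNReal.ofReal (1 / max ‖a p.1‖ ‖b p.2‖ ^ β) := by fun_prop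
  have hSfin : ∫⁻ p in V, S p * ENNReal.ofReal (1 / max ‖a p.1‖ ‖b p.2‖ ^ β) < ⊤ := by
    calc ∫⁻ p in V, S p * ENNReal.ofReal (1 / max ‖a p.1‖ ‖b p.2‖ ^ β)
        = ∫⁻ p in V, ∫⁻ θ in Set.Ioc 0 (2 * Real.pi),
            ENNReal.ofReal (‖G (weightedDilation w (circleMap 0 1 θ) p)‖ ^ 2) *
              ENNReal.ofReal (1 / max ‖a p.1‖ ‖b p.2‖ ^ β) := by
          refine lintegral_congr fun p => ?_
          rw [lintegral_mul_const' _ _ (by simp)]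
      _ = ∫⁻ θ in Set.Ioc 0 (2 * Real.pi), ∫⁻ p in V,
            ENNReal.ofReal (‖G (weightedDilation w (circleMap 0 1 θ) p)‖ ^ 2) *
              ENNReal.ofReal (1 / max ‖a p.1‖ ‖b p.2‖ ^ β) :=
          lintegral_lintegral_swap (hSint.mul (hMm.comp measurable_fst)).aemeasurable
      _ ≤ ∫⁻ θ in Set.Ioc 0 (2 * Real.pi), ∫⁻ p in V,
            ENNReal.ofReal (‖G p‖ ^ 2) * ENNReal.ofReal (1 / max ‖a p.1‖ ‖b p.2‖ ^ β) := by
          refine lintegral_mono fun θ => ?_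
          have hθ : ‖circleMap 0 1 θ‖ = 1 := by simp
          refine le_trans (le_of_eq ?_) (setLIntegral_comp_weightedDilation_le (w := w) hθ
            ((hG.norm.pow_const 2).ennreal_ofReal.mul hMm) y ε)
          refine lintegral_congr fun p => ?_
          simp [weightedDilation, hhom]
      _ < ⊤ := by
          rw [setLIntegral_const]
          exact ENNReal.mul_lt_top hfin measure_Ioc_lt_top
  have hρ : 0 < ‖c₁‖ * (1 / 2) ^ d := by positivity
  obtain ⟨C, hC, hker⟩ := exists_lintegral_rpow_linear_le hβ0 hβ hρ hc₂
  have hlin : Measurable fun q : ℂ × ((Fin n → ℂ) × (Fin m → ℂ)) =>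
      ENNReal.ofReal (1 / ‖q.1 * a q.2.1 + c₂ * b q.2.2‖ ^ β) := by fun_prop
  have hjoint : Measurable fun q : ℂ × ((Fin n → ℂ) × (Fin m → ℂ)) =>
      S q.2 * ENNReal.ofReal (1 / ‖q.1 * a q.2.1 + c₂ * b q.2.2‖ ^ β) :=
    (hSm.comp measurable_snd).mul hlin
  have havg : ∫⁻ s in Metric.ball (0 : ℂ) (‖c₁‖ * (1 / 2) ^ d), ∫⁻ p in V,
      S p * ENNReal.ofReal (1 / ‖s * a p.1 + c₂ * b p.2‖ ^ β) ≠ ⊤ := by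
    refine ne_of_lt ?_
    rw [lintegral_lintegral_swap hjoint.aemeasurable]
    calc ∫⁻ p in V, ∫⁻ s in Metric.ball (0 : ℂ) (‖c₁‖ * (1 / 2) ^ d),
          S p * ENNReal.ofReal (1 / ‖s * a p.1 + c₂ * b p.2‖ ^ β)
        ≤ ∫⁻ p in V, C * (S p * ENNReal.ofReal (1 / max ‖a p.1‖ ‖b p.2‖ ^ β)) := by
          refine lintegral_mono fun p => ?_
          rw [lintegral_const_mul _ (by fun_prop), mul_left_comm]
          gcongr
          exact hker _ _
      _ < ⊤ := by
          rw [lintegral_const_mul' _ _ hC]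
          exact ENNReal.mul_lt_top hC.lt_top hSfin
  have hae := ae_lt_top hjoint.lintegral_prod_right' havg
  have hne : ∀ᵐ s ∂(volume.restrict (Metric.ball (0 : ℂ) (‖c₁‖ * (1 / 2) ^ d))), s ≠ 0 :=
    ae_restrict_of_ae (measure_eq_zero_iff_ae_notMem.1 (measure_singleton (0 : ℂ)))
  have : (ae (volume.restrict (Metric.ball (0 : ℂ) (‖c₁‖ * (1 / 2) ^ d)))).NeBot := by
    rw [ae_neBot, Ne, Measure.restrict_eq_zero]
    exact (Metric.measure_ball_pos volume _ hρ).ne'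
  obtain ⟨s, ⟨hs, hs0⟩, hsball⟩ :=
    ((hae.and hne).and (ae_restrict_mem measurableSet_ball)).exists
  obtain ⟨lam, hlam⟩ := IsAlgClosed.exists_pow_nat_eq (s / c₁) hd
  have hlam0 : lam ≠ 0 := by
    rintro rfl
    rw [zero_pow hd.ne'] at hlam
    exact div_ne_zero hs0 hc₁ hlam.symm
  have hlam2 : ‖lam‖ ≤ 1 / 2 := by
    refine (pow_le_pow_iff_left₀ (norm_nonneg _) (by norm_num) hd.ne').1 ?_
    rw [← norm_pow, hlam, norm_div, div_le_iff₀ (norm_pos_iff.2 hc₁), mul_comm]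
    exact (mem_ball_zero_iff.1 hsball).le
  have hcs : c₁ * lam ^ d = s := by rw [hlam]; field_simp
  set F : (Fin n → ℂ) × (Fin m → ℂ) → ENNReal := fun p =>
    ENNReal.ofReal (‖G p‖ ^ 2) * ENNReal.ofReal (1 / ‖c₁ * a p.1 + c₂ * b p.2‖ ^ β) with hF
  have hFm : Measurable F := by fun_prop
  have hFdil : ∫⁻ p in V, F (weightedDilation w lam p) < ⊤ := by
    refine lt_of_le_of_lt (setLIntegral_mono' (g := fun p =>
      2 * (S p * ENNReal.ofReal (1 / ‖s * a p.1 + c₂ * b p.2‖ ^ β)))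
      measurableSet_ball fun p hp => ?_) ?_
    · have hdc : DiffContOnCl ℂ (fun u => G (weightedDilation w u p)) (Metric.ball 0 1) := by
        refine DifferentiableOn.diffContOnCl ?_
        rw [closure_ball _ one_ne_zero]
        refine hGd.comp (differentiable_weightedDilation_left w p).differentiableOn fun u hu => ?_
        exact weightedDilation_mem_ball w (mem_closedBall_zero_iff.1 hu) y hp
      have hfac : c₁ * a (weightedDilation w lam p).1 + c₂ * b (weightedDilation w lam p).2 =
          s * a p.1 + c₂ * b p.2 := by
        simp only [weightedDilation, hhom]
        rw [← hcs]; ring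
      simp only [hF, hfac]
      rw [← mul_assoc]
      gcongr
      exact sq_norm_le_circleAverage hdc hlam2
    · rw [lintegral_const_mul' _ _ (by simp)]
      exact ENNReal.mul_lt_top (by simp) hs
  have hcont (u : ℂ) : Continuous (weightedDilation w u : (Fin n → ℂ) × (Fin m → ℂ) → _) :=
    (continuous_weightedDilation w).comp (continuous_const.prodMk continuous_id)
  set V' := V ∩ weightedDilation w lam⁻¹ ⁻¹' V
  have hV'o : IsOpen V' := Metric.isOpen_ball.inter (Metric.isOpen_ball.preimage (hcont _))
  have hxV : ((0 : Fin n → ℂ), y) ∈ V := Metric.mem_ball_self hε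
  have hfix : weightedDilation w lam⁻¹ ((0 : Fin n → ℂ), y) = (0, y) := by
    ext j <;> simp [weightedDilation]
  refine ⟨V', hV'o, ⟨hxV, by simpa [hfix] using hxV⟩, Set.inter_subset_left, ?_⟩
  obtain ⟨K, hK0, hmap⟩ := exists_map_weightedDilation_eq_smul (m := m) w hlam0
  have hpush : K * ∫⁻ p in V', F p ≤ ∫⁻ p in V, F (weightedDilation w lam p) := by
    rw [← smul_eq_mul, ← lintegral_smul_measure, ← Measure.restrict_smul, ← hmap,
      setLIntegral_map hV'o.measurableSet hFm (hcont lam).measurable]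
    refine lintegral_mono_set fun p hp => ?_
    simpa [weightedDilation_comp_inv w hlam0] using hp.2
  by_contra htop
  rw [not_lt, top_le_iff] at htop
  rw [htop, ENNReal.mul_top hK0] at hpush
  exact absurd hFdil (not_lt.2 hpush)

theorem ae_mul_add_mul_ne_zero (hb : Measurable b) (ha : Measurable a)
    (hlevel : ∀ t, volume {z | a z = t} = 0) {c₁ c₂ : ℂ} (hc₁ : c₁ ≠ 0) :
    ∀ᵐ p : (Fin n → ℂ) × (Fin m → ℂ), c₁ * a p.1 + c₂ * b p.2 ≠ 0 := by
  have hmeas : MeasurableSet {p : (Fin n → ℂ) × (Fin m → ℂ) | c₁ * a p.1 + c₂ * b p.2 = 0} :=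
    measurableSet_eq_fun (by fun_prop) measurable_const
  suffices volume {p : (Fin n → ℂ) × (Fin m → ℂ) | c₁ * a p.1 + c₂ * b p.2 = 0} = 0 from
    measure_eq_zero_iff_ae_notMem.1 this
  rw [Measure.volume_eq_prod, Measure.prod_apply_symm hmeas, ← lintegral_zero]
  refine lintegral_congr fun v => ?_
  refine measure_mono_null (fun z hz => ?_) (hlevel (-(c₂ * b v) / c₁))
  have hz' : c₁ * a z + c₂ * b v = 0 := hz
  show a z = _
  rw [eq_div_iff hc₁]
  linear_combination hz'

theorem setLIntegral_max_lt_top (ha : Measurable a) (hb : Measurable b)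
    (hlevel : ∀ t, volume {z | a z = t} = 0) (hβ : 0 < β)
    {V : Set ((Fin n → ℂ) × (Fin m → ℂ))} {c₁ c₂ : ℂ} (hc₁ : c₁ ≠ 0)
    (hfin : ∫⁻ p in V, ENNReal.ofReal (‖G p‖ ^ 2) *
        ENNReal.ofReal (1 / ‖c₁ * a p.1 + c₂ * b p.2‖ ^ β) < ⊤) :
    ∫⁻ p in V, ENNReal.ofReal (‖G p‖ ^ 2) *
      ENNReal.ofReal (1 / max ‖a p.1‖ ‖b p.2‖ ^ β) < ⊤ := by
  set D := ‖c₁‖ + ‖c₂‖ with hD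
  have hD0 : 0 < D := add_pos_of_pos_of_nonneg (norm_pos_iff.2 hc₁) (norm_nonneg _)
  refine lt_of_le_of_lt (lintegral_mono_ae (g := fun p => ENNReal.ofReal (D ^ β) *
    (ENNReal.ofReal (‖G p‖ ^ 2) * ENNReal.ofReal (1 / ‖c₁ * a p.1 + c₂ * b p.2‖ ^ β))) ?_) ?_
  · filter_upwards [ae_restrict_of_ae (ae_mul_add_mul_ne_zero (c₂ := c₂) hb ha hlevel hc₁)]
      with p hp
    have hle : ‖c₁ * a p.1 + c₂ * b p.2‖ ≤ D * max ‖a p.1‖ ‖b p.2‖ := by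
      refine (norm_add_le _ _).trans ?_
      rw [norm_mul, norm_mul, hD, add_mul]
      gcongr
      · exact le_max_left _ _
      · exact le_max_right _ _
    have hpos := norm_pos_iff.2 hp
    have hmax : 0 < max ‖a p.1‖ ‖b p.2‖ := pos_of_mul_pos_right (hpos.trans_le hle) hD0.le
    rw [mul_left_comm]
    gcongr
    rw [← ENNReal.ofReal_mul (by positivity)]
    apply ENNReal.ofReal_le_ofReal
    rw [mul_one_div, div_le_div_iff₀ (by positivity) (by positivity), one_mul,
      ← Real.mul_rpow hD0.le hmax.le]
    exact Real.rpow_le_rpow hpos.le hle hβ.le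
  · rw [lintegral_const_mul' _ _ (by simp)]
    exact ENNReal.mul_lt_top (by simp) hfin

end Integrability

theorem ContinuousOn.measurable_indicator {X : Type*} [TopologicalSpace X] [MeasurableSpace X]
    [BorelSpace X] {f : X → ℂ} {s : Set X} (hf : ContinuousOn f s) (hs : IsOpen s) :
    Measurable (s.indicator f) := by
  classical
  rw [← Set.piecewise_eq_indicator]
  exact hf.measurable_piecewise continuousOn_const hs.measurableSet

/-- For `0 < α < 1`, the multiplier condition for `c₁ a + c₂ b` with `a` weighted homogeneous is
the multiplier condition for the ideal generated by `a` and `b`. -/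
theorem multCond_iff_max {n m : ℕ} {w : Fin n → ℕ} {d : ℕ} {a : (Fin n → ℂ) → ℂ}
    (ha : Measurable a) (hlevel : ∀ t, volume {z | a z = t} = 0)
    (hhom : ∀ (lam : ℂ) (z : Fin n → ℂ), a (fun j => lam ^ w j * z j) = lam ^ d * a z)
    (hd : 0 < d) {U : Set (Fin m → ℂ)} (hU : IsOpen U) {b : (Fin m → ℂ) → ℂ}
    (hb : ContinuousOn b U) {y : Fin m → ℂ} {α : ℝ} (hα0 : 0 < α) (hα1 : α < 1)
    {c₁ c₂ : ℂ} (hc₁ : c₁ ≠ 0) (hc₂ : c₂ ≠ 0) (g : (Fin n → ℂ) × (Fin m → ℂ) → ℂ) :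
    MultCond (fun p => c₁ * a p.1 + c₂ * b p.2) (Set.univ ×ˢ U) g (0, y) α ↔
      ∃ ε > 0, Metric.ball ((0 : Fin n → ℂ), y) ε ⊆ Set.univ ×ˢ U ∧
        DifferentiableOn ℂ g (Metric.ball (0, y) ε) ∧
        ∫⁻ p in Metric.ball (0, y) ε, ENNReal.ofReal (‖g p‖ ^ 2) *
          ENNReal.ofReal (1 / max ‖a p.1‖ ‖b p.2‖ ^ (2 * α)) < ⊤ := by
  have hbm := hb.measurable_indicator hU
  have hβ0 : 0 < 2 * α := by linarith
  constructor
  · rintro ⟨V, hVo, hxV, hVU, hgV, hint⟩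
    obtain ⟨ε, hε, hball⟩ := Metric.isOpen_iff.1 hVo _ hxV
    refine ⟨ε, hε, hball.trans hVU, hgV.mono hball, ?_⟩
    have hbU : ∀ p ∈ Metric.ball ((0 : Fin n → ℂ), y) ε, U.indicator b p.2 = b p.2 :=
      fun p hp => Set.indicator_of_mem (hVU (hball hp)).2 _
    have hmax := setLIntegral_max_lt_top (G := g) (V := Metric.ball (0, y) ε) (c₂ := c₂) ha hbm
      hlevel hβ0 hc₁ (by
        refine lt_of_le_of_lt (le_of_eq ?_) (hint.mono_set hball).setLIntegral_lt_top
        refine setLIntegral_congr_fun measurableSet_ball fun p hp => ?_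
        simp only [hbU p hp]
        rw [← ENNReal.ofReal_mul (by positivity), mul_one_div])
    refine lt_of_le_of_lt (le_of_eq ?_) hmax
    exact setLIntegral_congr_fun measurableSet_ball fun p hp => by simp only [hbU p hp]
  · rintro ⟨ε, hε, hball, hg, hfin⟩
    set B := Metric.ball ((0 : Fin n → ℂ), y) ε
    have hbU : ∀ p ∈ B, U.indicator b p.2 = b p.2 :=
      fun p hp => Set.indicator_of_mem (hball hp).2 _
    have hgB : ∀ p ∈ B, B.indicator g p = g p := fun p hp => Set.indicator_of_mem hp _
    have hGm : Measurable (B.indicator g) := hg.continuousOn.measurable_indicator Metric.isOpen_ball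
    obtain ⟨V, hVo, hxV, hVB, hV⟩ := exists_setLIntegral_lt_top_of_max (G := B.indicator g)
      ha hbm hhom hd hβ0 (by linarith) hε hGm (hg.congr hgB) (by
        refine lt_of_le_of_lt (le_of_eq ?_) hfin
        exact setLIntegral_congr_fun measurableSet_ball fun p hp => by
          simp only [hbU p hp, hgB p hp]) hc₁ hc₂
    refine ⟨V, hVo, hxV, hVB.trans hball, hg.mono hVB, ?_⟩
    have hint : IntegrableOn (fun p => ‖B.indicator g p‖ ^ 2 /
        ‖c₁ * a p.1 + c₂ * U.indicator b p.2‖ ^ (2 * α)) V volume := by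
      refine ⟨Measurable.aestronglyMeasurable (by fun_prop), ?_⟩
      rw [hasFiniteIntegral_iff_ofReal (Eventually.of_forall fun p => by positivity)]
      refine lt_of_le_of_lt (le_of_eq (lintegral_congr fun p => ?_)) hV
      rw [← ENNReal.ofReal_mul (by positivity), mul_one_div]
    exact hint.congr_fun (fun p hp => by simp only [hbU p (hVB hp), hgB p (hVB hp)])
      hVo.measurableSet

/-- Germ-level version of (2.7.5) in the weighted homogeneous case: if `f₁` is a nonzero
weighted homogeneous polynomial vanishing at `0` and `f₂` is a holomorphic germ vanishing
at `x₂`, then for all nonzero `c₁, c₂ ∈ ℂ` and rational `α ∈ (0,1)` the multiplier ideal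
germs of `(c₁f₁ + c₂f₂)^α` and `(f₁ + f₂)^α` at `x = (0, x₂)` coincide. -/
theorem multiplier_ideal_scaling_invariance
    {n₁ n₂ : ℕ} (hn₁ : 1 ≤ n₁) (hn₂ : 1 ≤ n₂)
    (P : MvPolynomial (Fin n₁) ℂ) (hP : P ≠ 0)
    (f₁ : (Fin n₁ → ℂ) → ℂ) (hf₁ : f₁ = fun z => MvPolynomial.eval z P)
    (hf₁0 : f₁ 0 = 0)
    (w : Fin n₁ → ℕ) (hw : ∀ j, 0 < w j) (dd : ℕ) (hdd : 0 < dd)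
    (hhom : ∀ (lam : ℂ) (z : Fin n₁ → ℂ),
      f₁ (fun j => lam ^ w j * z j) = lam ^ dd * f₁ z)
    (U₂ : Set (Fin n₂ → ℂ)) (hU₂ : IsOpen U₂)
    (f₂ : (Fin n₂ → ℂ) → ℂ) (hf₂ : DifferentiableOn ℂ f₂ U₂)
    (x₂ : Fin n₂ → ℂ) (hx₂ : x₂ ∈ U₂) (hf₂0 : f₂ x₂ = 0) (hne₂ : ¬ (f₂ =ᶠ[𝓝 x₂] 0))
    (x : (Fin n₁ → ℂ) × (Fin n₂ → ℂ)) (hx : x = (0, x₂))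
    (c₁ c₂ : ℂ) (hc₁ : c₁ ≠ 0) (hc₂ : c₂ ≠ 0)
    (α : ℚ) (hα0 : 0 < α) (hα1 : α < 1)
    (g : ((Fin n₁ → ℂ) × (Fin n₂ → ℂ)) → ℂ) (hg : HolNear g x) :
    MultCond (fun p => c₁ * f₁ p.1 + c₂ * f₂ p.2) (Set.univ ×ˢ U₂) g x (α : ℝ) ↔
      MultCond (fun p => f₁ p.1 + f₂ p.2) (Set.univ ×ˢ U₂) g x (α : ℝ) := by
  subst hx
  have ha : Measurable f₁ := hf₁ ▸ P.continuous_eval.measurable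
  have hlevel (t : ℂ) : volume {z | f₁ z = t} = 0 := by
    subst hf₁
    exact P.volume_eval_eq hP hf₁0 t
  have key {k₁ k₂ : ℂ} (hk₁ : k₁ ≠ 0) (hk₂ : k₂ ≠ 0) :=
    multCond_iff_max (y := x₂) ha hlevel hhom hdd hU₂ hf₂.continuousOn (α := (α : ℝ))
      (by exact_mod_cast hα0) (by exact_mod_cast hα1) hk₁ hk₂ g
  rw [key hc₁ hc₂, ← key one_ne_zero one_ne_zero]
  simp only [one_mul]
end
end

section
/- Let R be a ring and M an R-module. Let F, G : ℤ → Submodule R M be decreasing filtrations by submodules (F^{p+1} ⊆ F^p and G^{p+1} ⊆ G^p for all p), and suppose there is an integer N with F^p = G^p = M for all p ≤ −N and F^p = G^p = 0 for all p ≥ N. Define the convolution filtration (F▿G)^p := Σ_{q ∈ ℤ} (F^q ∩ G^{p−q}), a decreasing filtration of M by submodules. For each q the inclusions F^{q+1} ∩ G^{p−q} ⊆ (F▿G)^{p+1} and F^q ∩ G^{p−q+1} ⊆ (F▿G)^{p+1} hold, so the inclusion F^q ∩ G^{p−q} ⊆ (F▿G)^p induces a well-defined R-linear map (F^q ∩ G^{p−q})/(F^{q+1}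 ∩ G^{p−q} + F^q ∩ G^{p−q+1}) → (F▿G)^p/(F▿G)^{p+1}. Then for every p ∈ ℤ, the sum of these maps over q ∈ ℤ is an isomorphism of R-modules ⊕_{q ∈ ℤ} (F^q ∩ G^{p−q})/(F^{q+1} ∩ G^{p−q} + F^q ∩ G^{p−q+1}) ≅ (F▿G)^p/(F▿G)^{p+1}. -/
noncomputable section

variable {R : Type*} {M : Type*} [Ring R] [AddCommGroup M] [Module R M]

/-- convolution of two decreasing `ℤ`-indexed filtrations by submodules:
`(F▿G)^p = Σ_q (F^q ∩ G^{p-q})`. -/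
def convFilt (F G : ℤ → Submodule R M) (p : ℤ) : Submodule R M :=
  ⨆ q : ℤ, F q ⊓ G (p - q)

/-- quotient `A/B` for submodules `B ≤ A` of `M`. -/
abbrev subQuot (A B : Submodule R M) : Type _ :=
  A ⧸ (B.comap A.subtype)

/-- the graded piece `Gr_F^q Gr_G^{p-q} M = (F^q ∩ G^{p-q})/(F^{q+1} ∩ G^{p-q} + F^q ∩ G^{p-q+1})`. -/
abbrev grPiece (F G : ℤ → Submodule R M) (p q : ℤ) : Type _ :=
  subQuot (F q ⊓ G (p - q)) ((F (q + 1) ⊓ G (p - q)) ⊔ (F q ⊓ G (p - q + 1)))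

lemma grPiece_le_conv (F G : ℤ → Submodule R M) (p q : ℤ) :
    F q ⊓ G (p - q) ≤ convFilt F G p :=
  le_iSup (fun q' => F q' ⊓ G (p - q')) q

lemma grPiece_num_le_conv_succ (F G : ℤ → Submodule R M) (p q : ℤ) :
    (F (q + 1) ⊓ G (p - q)) ⊔ (F q ⊓ G (p - q + 1)) ≤ convFilt F G (p + 1) := by
  apply sup_le
  · have h : p - q = p + 1 - (q + 1) := by omega
    rw [h]
    exact le_iSup (fun q' => F q' ⊓ G (p + 1 - q')) (q + 1)
  · have h : p - q + 1 = p + 1 - q := by omega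
    rw [h]
    exact le_iSup (fun q' => F q' ⊓ G (p + 1 - q')) q

/-- the `R`-linear map `Gr_F^q Gr_G^{p-q} M → Gr_{F▿G}^p M` induced by the inclusion
`F^q ∩ G^{p-q} ⊆ (F▿G)^p`. -/
def grMap (F G : ℤ → Submodule R M) (p q : ℤ) :
    grPiece F G p q →ₗ[R] subQuot (convFilt F G p) (convFilt F G (p + 1)) :=
  Submodule.liftQ _
    ((Submodule.mkQ _).comp (Submodule.inclusion (grPiece_le_conv F G p q)))
    (by
      intro a ha
      simp only [LinearMap.mem_ker, LinearMap.comp_apply, Submodule.mkQ_apply,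
        Submodule.Quotient.mk_eq_zero, Submodule.mem_comap]
      exact grPiece_num_le_conv_succ F G p q ha)

lemma mem_inf_sup_inf_of_sum_eq_zero {F G : ℤ → Submodule R M} (hF : Antitone F)
    (hG : Antitone G) {p : ℤ} {s : Finset ℤ} {c : ℤ → M}
    (hc : ∀ q, c q ∈ F q ⊓ G (p - q)) (hsum : ∑ q ∈ s, c q = 0) {q : ℤ} (hq : q ∈ s) :
    c q ∈ (F (q + 1) ⊓ G (p - q)) ⊔ (F q ⊓ G (p - q + 1)) := by
  have hsplit : ∑ r ∈ s with r ≤ q, c r = c q + ∑ r ∈ s with r < q, c r := by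
    have h : s.filter (· ≤ q) = insert q (s.filter (· < q)) := by
      ext r
      simp only [Finset.mem_filter, Finset.mem_insert]
      grind
    rw [h, Finset.sum_insert (by simp)]
  have hle := Finset.sum_filter_add_sum_filter_not s (· ≤ q) c
  have hlt := Finset.sum_filter_add_sum_filter_not s (· < q) c
  rw [hsum] at hle hlt
  have hcq : c q = ∑ r ∈ s with r ≤ q, c r + -∑ r ∈ s with r < q, c r := by
    rw [hsplit]
    abel
  rw [hcq]
  refine Submodule.add_mem_sup ⟨?_, ?_⟩ (Submodule.neg_mem _ ⟨?_, ?_⟩)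
  · rw [eq_neg_of_add_eq_zero_left hle]
    refine Submodule.neg_mem _ (Submodule.sum_mem _ fun r hr => hF ?_ (hc r).1)
    have := (Finset.mem_filter.mp hr).2
    omega
  · refine Submodule.sum_mem _ fun r hr => hG ?_ (hc r).2
    have := (Finset.mem_filter.mp hr).2
    omega
  · rw [eq_neg_of_add_eq_zero_left hlt]
    refine Submodule.neg_mem _ (Submodule.sum_mem _ fun r hr => hF ?_ (hc r).1)
    have := (Finset.mem_filter.mp hr).2
    omega
  · refine Submodule.sum_mem _ fun r hr => hG ?_ (hc r).2
    have := (Finset.mem_filter.mp hr).2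
    omega

lemma mem_of_sum_mem_convFilt_succ {F G : ℤ → Submodule R M} (hF : Antitone F)
    (hG : Antitone G) {p : ℤ} {a : ℤ →₀ M} (ha : ∀ q, a q ∈ F q ⊓ G (p - q))
    (hsum : (a.sum fun _ x => x) ∈ convFilt F G (p + 1)) (q : ℤ) :
    a q ∈ (F (q + 1) ⊓ G (p - q)) ⊔ (F q ⊓ G (p - q + 1)) := by
  obtain ⟨b, hb, hab⟩ := (Submodule.mem_iSup_iff_exists_finsupp _ _).mp hsum
  have hb' : ∀ r, b r ∈ F r ⊓ G (p - r + 1) := fun r => by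
    rw [show p - r + 1 = p + 1 - r by omega]
    exact hb r
  have hzero : ∑ r ∈ insert q (a.support ∪ b.support), (a r - b r) = 0 := by
    rw [Finset.sum_sub_distrib, sub_eq_zero,
      ← Finsupp.sum_of_support_subset a (by grind) (fun _ x => x) (by simp),
      ← Finsupp.sum_of_support_subset b (by grind) (fun _ x => x) (by simp), hab]
  have hmem := mem_inf_sup_inf_of_sum_eq_zero hF hG (c := fun r => a r - b r)
    (fun r => Submodule.sub_mem _ (ha r) ⟨(hb' r).1, hG (by omega) (hb' r).2⟩) hzero
    (Finset.mem_insert_self _ _)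
  simpa using Submodule.add_mem _ hmem (Submodule.mem_sup_right (hb' q))

lemma exists_finsupp_of_directSum_grPiece (F G : ℤ → Submodule R M) (p : ℤ)
    (x : DirectSum ℤ fun q => grPiece F G p q) :
    ∃ (a : ℤ →₀ M) (ha : ∀ q, a q ∈ F q ⊓ G (p - q))
      (hsum : (a.sum fun _ m => m) ∈ convFilt F G p),
      (∀ q, x q = Submodule.Quotient.mk ⟨a q, ha q⟩) ∧
      DirectSum.toModule R ℤ (subQuot (convFilt F G p) (convFilt F G (p + 1)))
        (fun q => grMap F G p q) x = Submodule.Quotient.mk ⟨a.sum fun _ m => m, hsum⟩ := by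
  induction x using DirectSum.induction_on with
  | zero => exact ⟨0, by simp, by simp, fun q => rfl, by rw [map_zero]; rfl⟩
  | of i y =>
    obtain ⟨m, rfl⟩ := Submodule.Quotient.mk_surjective _ y
    have ha : ∀ q, Finsupp.single i (m : M) q ∈ F q ⊓ G (p - q) := fun q => by
      by_cases h : i = q
      · subst h
        rw [Finsupp.single_eq_same]
        exact m.2
      · rw [Finsupp.single_eq_of_ne (Ne.symm h)]
        exact Submodule.zero_mem _
    have hs : ((Finsupp.single i (m : M)).sum fun _ m => m) = m := Finsupp.sum_single_index rfl
    refine ⟨Finsupp.single i m, ha, by rw [hs]; exact grPiece_le_conv F G p i m.2, fun q => ?_, ?_⟩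
    · by_cases h : i = q
      · subst h
        rw [DirectSum.of_eq_same]
        congr 1
        exact Subtype.ext Finsupp.single_eq_same.symm
      · rw [DirectSum.of_eq_of_ne _ _ _ (Ne.symm h)]
        symm
        rw [Submodule.Quotient.mk_eq_zero]
        simp [Finsupp.single_eq_of_ne (Ne.symm h)]
    · refine (DirectSum.toModule_lof R i _).trans ?_
      simp only [hs]
      rfl
  | add x y hx hy =>
    obtain ⟨a, ha, hsa, hxa, hxs⟩ := hx
    obtain ⟨b, hb, hsb, hyb, hys⟩ := hy
    have hs : ((a + b).sum fun _ m => m) = (a.sum fun _ m => m) + b.sum fun _ m => m :=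
      Finsupp.sum_add_index' (fun _ => rfl) (fun _ _ _ => rfl)
    refine ⟨a + b, fun q => Submodule.add_mem _ (ha q) (hb q),
      by rw [hs]; exact Submodule.add_mem _ hsa hsb, fun q => ?_, ?_⟩
    · rw [DirectSum.add_apply, hxa, hyb]
      rfl
    · rw [map_add, hxs, hys]
      simp only [hs]
      rfl

/-- Remark 1.3 (case `m = 2`): for decreasing exhaustive bounded filtrations `F`, `G`, the
sum over `q` of the induced maps `Gr_F^q Gr_G^{p-q} M → Gr_{F▿G}^p M` is an isomorphism
`⊕_q Gr_F^q Gr_G^{p-q} M ≅ Gr_{F▿G}^p M`. -/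
theorem convFilt_graded_decomposition
    (F G : ℤ → Submodule R M)
    (hF : ∀ p : ℤ, F (p + 1) ≤ F p) (hG : ∀ p : ℤ, G (p + 1) ≤ G p)
    (N : ℤ)
    (hFtop : ∀ p : ℤ, p ≤ -N → F p = ⊤) (hGtop : ∀ p : ℤ, p ≤ -N → G p = ⊤)
    (hFbot : ∀ p : ℤ, N ≤ p → F p = ⊥) (hGbot : ∀ p : ℤ, N ≤ p → G p = ⊥)
    (p : ℤ) :
    Function.Bijective
      (DirectSum.toModule R ℤ (subQuot (convFilt F G p) (convFilt F G (p + 1)))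
        (fun q => grMap F G p q)) := by
  constructor
  · rw [injective_iff_map_eq_zero]
    intro x hx
    obtain ⟨a, ha, hsum, hxa, hxs⟩ := exists_finsupp_of_directSum_grPiece F G p x
    rw [hxs, Submodule.Quotient.mk_eq_zero] at hx
    refine DFinsupp.ext fun q => (hxa q).trans ((Submodule.Quotient.mk_eq_zero _).mpr ?_)
    exact mem_of_sum_mem_convFilt_succ (antitone_int_of_succ_le hF)
      (antitone_int_of_succ_le hG) ha hx q
  · intro y
    obtain ⟨⟨m, hm⟩, rfl⟩ := Submodule.Quotient.mk_surjective _ y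
    induction hm using Submodule.iSup_induction' with
    | mem q m hm =>
      exact ⟨DirectSum.lof R ℤ (fun q => grPiece F G p q) q (Submodule.Quotient.mk ⟨m, hm⟩),
        DirectSum.toModule_lof R q _⟩
    | zero => exact ⟨0, map_zero _⟩
    | add m n hm hn ihm ihn =>
      obtain ⟨x, hx⟩ := ihm
      obtain ⟨z, hz⟩ := ihn
      exact ⟨x + z, by rw [map_add, hx, hz]; rfl⟩
end
end

section
/- Let R be a ring and M an R-module. Let F, G : ℤ → Submodule R M be decreasing filtrations by submodules (F^{p+1} ⊆ F^p and G^{p+1} ⊆ G^p for all p). Define the convolution filtration (F▿G)^p := Σ_{q ∈ ℤ} (F^q ∩ G^{p−q}). Then for all integers p and r one has the equality of submodules of M: ((F▿G)^p ∩ G^r) + G^{r+1} = (F^{p−r} ∩ G^r) + G^{r+1}. Equivalently, the filtration induced by F▿G on the graded piece Gr_G^r M = G^r/G^{r+1} coincides with the filtration induced by F shifted by r: Gr_{F▿G}^p Gr_G^r M = Gr traced out by the image of F^{p−r} ∩ G^r. -/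
noncomputable section

variable {R : Type*} {M : Type*} [Ring R] [AddCommGroup M] [Module R M]

theorem convFilt_le_sup {F G : ℤ → Submodule R M} (hF : Antitone F) (hG : Antitone G)
    (p r : ℤ) : convFilt F G p ≤ G (r + 1) ⊔ F (p - r) := by
  refine iSup_le fun q => ?_
  rcases le_or_gt (p - q) r with h | h
  · exact inf_le_left.trans ((hF (by lia)).trans le_sup_right)
  · exact inf_le_right.trans ((hG (by lia)).trans le_sup_left)

theorem inf_le_convFilt (F G : ℤ → Submodule R M) (p r : ℤ) :
    F (p - r) ⊓ G r ≤ convFilt F G p := by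
  simpa [convFilt] using le_iSup (fun q : ℤ => F q ⊓ G (p - q)) (p - r)

/-- The filtration induced by the convolution `F▿G` on the graded piece `Gr_G^r M`
coincides with the filtration induced by `F` shifted by `r`:
`((F▿G)^p ∩ G^r) + G^{r+1} = (F^{p-r} ∩ G^r) + G^{r+1}`. -/
theorem convFilt_inf_grade_eq
    (F G : ℤ → Submodule R M)
    (hF : ∀ p : ℤ, F (p + 1) ≤ F p) (hG : ∀ p : ℤ, G (p + 1) ≤ G p)
    (p r : ℤ) :
    (convFilt F G p ⊓ G r) ⊔ G (r + 1) = (F (p - r) ⊓ G r) ⊔ G (r + 1) := by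
  apply le_antisymm
  · refine sup_le ?_ le_sup_right
    calc convFilt F G p ⊓ G r
        ≤ (G (r + 1) ⊔ F (p - r)) ⊓ G r :=
          inf_le_inf_right _ (convFilt_le_sup (antitone_int_of_succ_le hF)
            (antitone_int_of_succ_le hG) p r)
      _ = G (r + 1) ⊔ F (p - r) ⊓ G r := sup_inf_assoc_of_le _ (hG r)
      _ = F (p - r) ⊓ G r ⊔ G (r + 1) := sup_comm _ _
  · exact sup_le_sup_right (le_inf (inf_le_convFilt F G p r) inf_le_right) _
end
end
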